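/- arXiv:1008.3099 — 2 statements merged into one kernel-verified Lean document; each statement's English description precedes it below -/
import Mathlib

section
/- For a compactly supported probability measure $\mu$ on $\mathbb{R}$ with $F_\mu(z) = 1/G_\mu(z)$ where $G_\mu(z) = \int (z-s)^{-1} d\mu(s)$, there exists a unique finite positive measure $\rho$ on $\mathbb{R}$ with total mass $\rho(\mathbb{R}) = \mathrm{VAR}(\mu) = \int s^2\,d\mu(s) - (\int s\,d\mu(s))^2$ such that $F_\mu(z) = z - \int s\,d\mu(s) + \int_\mathbb{R} \frac{1}{s-z}\,d\rho(s)$ for all $z$ in the upper half-plane. -/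
open MeasureTheory

/-- The Cauchy–Stieltjes transform `G_μ(z) = ∫ (z - s)⁻¹ dμ(s)`. -/
noncomputable def cauchyTransform (μ : Measure ℝ) (z : ℂ) : ℂ :=
  ∫ s, (z - (s : ℂ))⁻¹ ∂μ

/-- The reciprocal Cauchy transform `F_μ = 1 / G_μ`. -/
noncomputable def Ftransform (μ : Measure ℝ) (z : ℂ) : ℂ :=
  (cauchyTransform μ z)⁻¹

/-- The topological support of a measure on `ℝ`. -/
def msupport (μ : Measure ℝ) : Set ℝ :=
  {x | ∀ U ∈ nhds x, μ U ≠ 0}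

/-- `[μ]`: the maximum of the absolute values of points of the support. -/
noncomputable def suppBound (μ : Measure ℝ) : ℝ :=
  sSup ((fun v => |v|) '' msupport μ)

/-- The variance `VAR(μ) = ∫ s² dμ - (∫ s dμ)²`. -/
noncomputable def varM (μ : Measure ℝ) : ℝ :=
  (∫ s, s ^ 2 ∂μ) - (∫ s, s ∂μ) ^ 2

/-- `ν` is the free additive convolution semigroup `t ↦ μ^{⊞ t}` (for `t ≥ 1`) of `μ`,
characterized by the subordination relations
`F_{μ^{⊞t}}(z) = F_μ(ω_t(z))`, `ω_t(z) = z/t + (1 - 1/t) F_{μ^{⊞t}}(z)`. -/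
def IsFreePowerFamily (μ : Measure ℝ) (ν : ℝ → Measure ℝ) : Prop :=
  ν 1 = μ ∧
  (∀ t, 1 ≤ t → IsProbabilityMeasure (ν t) ∧ Bornology.IsBounded (msupport (ν t))) ∧
  ∀ t, 1 ≤ t → ∀ z : ℂ, 0 < z.im →
    Ftransform (ν t) z =
      Ftransform μ (((t : ℂ))⁻¹ * z + (1 - ((t : ℂ))⁻¹) * Ftransform (ν t) z)

open Filter Topology
open scoped ENNReal CompactlySupported
lemma spectral_aux {H : Type*} [NormedAddCommGroup H] [InnerProductSpace ℂ H] [CompleteSpace H]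
    (A : H →L[ℂ] H) (hA : IsSelfAdjoint A) (v : H) :
    ∃ ρ : Measure ℝ, IsFiniteMeasure ρ ∧ ρ Set.univ = ENNReal.ofReal (‖v‖ ^ 2) ∧
      ∀ z : ℂ, 0 < z.im → ∃ w : H, A w - z • w = v ∧
        inner ℂ v w = ∫ s, ((s : ℂ) - z)⁻¹ ∂ρ := by
  let K := spectrum ℝ A
  let Φ : C(K, ℝ) →⋆ₐ[ℝ] (H →L[ℂ] H) := cfcHom (R := ℝ) hA
  have : CompactSpace K := isCompact_iff_compactSpace.mp (spectrum.isCompact A)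
  have hreal : ∀ f : C(K, ℝ), inner ℂ v (Φ f v) = ((inner ℂ v (Φ f v)).re : ℂ) := by
    intro f
    have hs : IsSelfAdjoint (Φ f) := by
      have : IsSelfAdjoint f := by ext x; simp
      exact this.map Φ
    have := hs.isSymmetric v v
    apply Complex.ext
    · simp
    · have h2 := congrArg Complex.im this
      have h3 : (inner ℂ (Φ f v) v).im = -(inner ℂ v (Φ f v)).im := by
        rw [← inner_conj_symm]; rfl
      simp at h2 ⊢
      linarith
  have hpos : ∀ f : C(K, ℝ), 0 ≤ f → 0 ≤ (inner ℂ v (Φ f v)).re := by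
    intro f hf
    have h1 : 0 ≤ Φ f := cfcHom_nonneg_iff hA |>.2 hf
    have h2 := (ContinuousLinearMap.nonneg_iff_isPositive _).1 h1
    exact h2.re_inner_nonneg_right v
  let Λ : C_c(K, ℝ) →ₚ[ℝ] ℝ := PositiveLinearMap.mk₀
    { toFun := fun f => (inner ℂ v (Φ f.toContinuousMap v)).re
      map_add' := by
        intro f g
        have : (f + g).toContinuousMap = f.toContinuousMap + g.toContinuousMap := rfl
        rw [this, map_add]; simp [inner_add_right]
      map_smul' := by
        intro c f
        have : (c • f).toContinuousMap = c • f.toContinuousMap := rfl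
        rw [this, map_smul]; simp [inner_smul_right_eq_smul] } (by
        intro f hf
        exact hpos f.toContinuousMap (fun x => hf x))
  let τ := RealRMK.rieszMeasure Λ
  have hτ : ∀ f : C(K, ℝ), ∫ x, f x ∂τ = (inner ℂ v (Φ f v)).re := by
    intro f
    exact RealRMK.integral_rieszMeasure Λ ⟨f, HasCompactSupport.of_compactSpace _⟩
  have hme : MeasurableEmbedding (Subtype.val : K → ℝ) :=
    MeasurableEmbedding.subtype_coe (spectrum.isCompact A).measurableSet
  refine ⟨τ.map Subtype.val, inferInstance, ?_, ?_⟩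
  · rw [Measure.map_apply measurable_subtype_coe MeasurableSet.univ, Set.preimage_univ]
    have h1 := hτ 1
    simp only [ContinuousMap.one_apply, map_one, one_apply_eq_self, integral_const, smul_eq_mul, mul_one] at h1
    have h2 : (inner ℂ v v).re = ‖v‖ ^ 2 := by
      rw [inner_self_eq_norm_sq_to_K]; norm_cast
    rw [← h2, ← h1, measureReal_def, ENNReal.ofReal_toReal (measure_ne_top _ _)]
  · intro z hz
    have hne : ∀ s : ℝ, (s - z.re) ^ 2 + z.im ^ 2 ≠ 0 := fun s => by positivity
    let f1 : C(K, ℝ) := ⟨fun s => (s.1 - z.re) / ((s.1 - z.re) ^ 2 + z.im ^ 2), by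
      fun_prop (disch := intro; exact hne _)⟩
    let f2 : C(K, ℝ) := ⟨fun s => z.im / ((s.1 - z.re) ^ 2 + z.im ^ 2), by
      fun_prop (disch := intro; exact hne _)⟩
    let ι : C(K, ℝ) := (ContinuousMap.id ℝ).restrict K
    have hι : Φ ι = A := cfcHom_id hA
    have e1 : ι * f1 = z.re • f1 - z.im • f2 + 1 := by
      ext s
      simp only [ι, f1, f2, ContinuousMap.mul_apply, ContinuousMap.add_apply, ContinuousMap.sub_apply, ContinuousMap.smul_apply, ContinuousMap.one_apply, ContinuousMap.restrict_apply, ContinuousMap.coe_mk, ContinuousMap.id_apply, smul_eq_mul]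
      field_simp [hne s.1]
      ring
    have e2 : ι * f2 = z.re • f2 + z.im • f1 := by
      ext s
      simp only [ι, f1, f2, ContinuousMap.mul_apply, ContinuousMap.add_apply, ContinuousMap.smul_apply, ContinuousMap.restrict_apply, ContinuousMap.coe_mk, ContinuousMap.id_apply, smul_eq_mul]
      field_simp [hne s.1]
      ring
    have a1 : A (Φ f1 v) = z.re • Φ f1 v - z.im • Φ f2 v + v := by
      have := congrArg (fun T => T v) (congrArg Φ e1)
      simpa [hι] using this
    have a2 : A (Φ f2 v) = z.re • Φ f2 v + z.im • Φ f1 v := by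
      have := congrArg (fun T => T v) (congrArg Φ e2)
      simpa [hι] using this
    refine ⟨Φ f1 v + Complex.I • Φ f2 v, ?_, ?_⟩
    · rw [map_add, map_smul, a1, a2]
      have hz' : z = z.re + z.im * Complex.I := (Complex.re_add_im z).symm
      simp only [← Complex.coe_smul]
      generalize Φ f1 v = p
      generalize Φ f2 v = q
      have hzz : z • (p + Complex.I • q) = ((z.re : ℂ) + z.im * Complex.I) • (p + Complex.I • q) := by
        rw [← hz']
      rw [hzz]
      have hI := Complex.I_mul_I
      match_scalars <;> first | ring1 | linear_combination (exp := 1) (-(z.im : ℂ)) * hI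
    · rw [inner_add_right, inner_smul_right, hreal f1, hreal f2, ← hτ f1, ← hτ f2, hme.integral_map]
      rw [← integral_complex_ofReal, ← integral_complex_ofReal, ← integral_const_mul, ← integral_add]
      · congr 1
        ext s
        simp only [f1, f2, ContinuousMap.coe_mk]
        apply Complex.ext
        · simp [Complex.normSq_apply, ← pow_two, Complex.inv_re, -Complex.ofReal_div, -Complex.ofReal_sub]
        · simp [Complex.normSq_apply, ← pow_two, Complex.inv_im]
          norm_cast
          simp
      · have : Continuous fun a => ((f1 a : ℝ) : ℂ) := by fun_prop
        exact this.integrable_of_hasCompactSupport (HasCompactSupport.of_compactSpace _)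
      · have : Continuous fun a => Complex.I * ((f2 a : ℝ) : ℂ) := by fun_prop
        exact this.integrable_of_hasCompactSupport (HasCompactSupport.of_compactSpace _)

lemma schur_aux {H : Type*} [NormedAddCommGroup H] [InnerProductSpace ℂ H] [CompleteSpace H]
    (X : H →L[ℂ] H) (hX : IsSelfAdjoint X) (e : H) (he : ‖e‖ = 1) (m : ℝ)
    (hm : inner ℂ e (X e) = (m : ℂ)) :
    ∃ ρ : Measure ℝ, IsFiniteMeasure ρ ∧ ρ Set.univ = ENNReal.ofReal (‖X e‖ ^ 2 - m ^ 2) ∧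
      ∀ z : ℂ, 0 < z.im → ∃ h : H, inner ℂ e h = 1 ∧
        z • h - X h = (z - m + ∫ s, ((s : ℂ) - z)⁻¹ ∂ρ) • e := by
  have hee : inner ℂ e e = (1 : ℂ) := by
    rw [inner_self_eq_norm_sq_to_K, he]; simp
  let P : H →L[ℂ] H := 1 - (innerSL ℂ e).smulRight e
  have hP : ∀ x, P x = x - (inner ℂ e x) • e := fun x => by simp [P]
  have hPs : IsSelfAdjoint P := by
    rw [ContinuousLinearMap.isSelfAdjoint_iff_isSymmetric]
    intro x y
    simp only [ContinuousLinearMap.coe_coe, hP, inner_sub_left, inner_sub_right, inner_smul_left, inner_smul_right, inner_conj_symm]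
    ring
  have hsym := hX.isSymmetric
  have hA : IsSelfAdjoint (P * X * P) := by
    have := hX.conjugate P
    rwa [hPs.star_eq] at this
  obtain ⟨ρ, h1, h2, h3⟩ := spectral_aux (P * X * P) hA (P (X e))
  have hXe : inner ℂ (X e) e = (m : ℂ) := by rw [← hm]; exact hsym e e
  refine ⟨ρ, h1, ?_, ?_⟩
  · rw [h2]; congr 1
    have : ((‖P (X e)‖ ^ 2 : ℝ) : ℂ) = ((‖X e‖ ^ 2 - m ^ 2 : ℝ) : ℂ) := by
      push_cast
      have i1 := inner_self_eq_norm_sq_to_K (𝕜 := ℂ) (P (X e))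
      have i2 := inner_self_eq_norm_sq_to_K (𝕜 := ℂ) (X e)
      simp only [Complex.coe_algebraMap] at i1 i2
      rw [← i1, ← i2]
      simp only [hP, inner_sub_left, inner_sub_right, inner_smul_left, inner_smul_right, hee, hm, hXe, Complex.conj_ofReal]
      ring
    exact_mod_cast this
  · intro z hz
    obtain ⟨w, hw, hw2⟩ := h3 z hz
    have hz0 : z ≠ 0 := by rintro rfl; simp at hz
    have hPe : ∀ x, inner ℂ e (P x) = (0 : ℂ) := fun x => by
      rw [hP, inner_sub_right, inner_smul_right, hee]; ring
    have hew : inner ℂ e w = (0 : ℂ) := by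
      have := congrArg (fun x => inner ℂ e x) hw
      simp only [inner_sub_right, inner_smul_right, mul_apply_eq_comp, hPe] at this
      simpa [hz0] using this
    have hPw : P w = w := by rw [hP, hew]; simp
    refine ⟨e - w, by rw [inner_sub_right, hee, hew]; ring, ?_⟩
    rw [← hw2]
    have hi : inner ℂ (P (X e)) w = inner ℂ e (X w) := by
      rw [hP, inner_sub_left, inner_smul_left, hew, show inner ℂ e (X w) = inner ℂ (X e) w from (hsym e w).symm]; simp
    rw [hi]
    simp only [mul_apply_eq_comp, hPw] at hw
    rw [hP (X w), hP (X e), hm] at hw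
    rw [map_sub]
    have hw' : X w - inner ℂ e (X w) • e - z • w - (X e - (m : ℂ) • e) = 0 := sub_eq_zero.2 hw
    rw [← sub_eq_zero, ← hw']
    module

lemma poisson_limit (ρ : Measure ℝ) [IsFiniteMeasure ρ] (f : C_c(ℝ, ℝ)) :
    Tendsto (fun y : ℝ => ∫ x, f x * (∫ s, ((s : ℂ) - ((x : ℂ) + y * Complex.I))⁻¹ ∂ρ).im)
      (𝓝[>] 0) (𝓝 (Real.pi * ∫ s, f s ∂ρ)) := by
  obtain ⟨C, hC⟩ := f.hasCompactSupport.exists_bound_of_continuous f.continuous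
  have hfm : ∀ t y : ℝ, Measurable fun s => f (s + y * t) := fun t y =>
    (f.continuous.comp (by fun_prop : Continuous fun s : ℝ => s + y * t)).measurable
  have key : ∀ y : ℝ, 0 < y →
      (∫ x, f x * (∫ s, ((s : ℂ) - ((x : ℂ) + y * Complex.I))⁻¹ ∂ρ).im) =
      ∫ s, (∫ t, f (s + y * t) * (1 + t ^ 2)⁻¹) ∂ρ := by
    intro y hy
    have hden : ∀ s x : ℝ, (s - x) ^ 2 + y ^ 2 ≠ 0 := fun s x => by positivity
    have him : ∀ x : ℝ, (∫ s, ((s : ℂ) - ((x : ℂ) + y * Complex.I))⁻¹ ∂ρ).im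
        = ∫ s, y / ((s - x) ^ 2 + y ^ 2) ∂ρ := by
      intro x
      have hint : Integrable (fun s : ℝ => ((s : ℂ) - ((x : ℂ) + y * Complex.I))⁻¹) ρ := by
        refine Integrable.of_bound (C := y⁻¹) (by fun_prop) (ae_of_all _ fun s => ?_)
        rw [norm_inv]
        apply inv_anti₀ hy
        have := Complex.abs_im_le_norm ((s : ℂ) - ((x : ℂ) + y * Complex.I))
        simpa [abs_of_pos hy] using this
      have := integral_im hint
      simp only [RCLike.im_to_complex] at this
      rw [← this]
      congr 1; ext s
      simp [Complex.inv_im, Complex.normSq_apply, ← pow_two]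
    simp_rw [him, ← integral_const_mul]
    rw [integral_integral_swap]
    · congr 1; ext s
      have h1 := integral_add_left_eq_self (μ := volume) (fun x : ℝ => f x * (y / ((s - x) ^ 2 + y ^ 2))) s
      have h2 := Measure.integral_comp_mul_left (fun x : ℝ => f (s + x) * (y / ((s - (s + x)) ^ 2 + y ^ 2))) y
      rw [← h1]
      rw [abs_of_pos (inv_pos.2 hy), smul_eq_mul, eq_inv_mul_iff_mul_eq₀ hy.ne', ← integral_const_mul] at h2
      rw [← h2]
      congr 1; ext t
      have : 1 + t ^ 2 ≠ 0 := by positivity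
      have h3 : (s - (s + y * t)) ^ 2 + y ^ 2 = y ^ 2 * (1 + t ^ 2) := by ring
      rw [h3]; field_simp
    · have hf : Integrable (fun x => f x) volume :=
        f.continuous.integrable_of_hasCompactSupport f.hasCompactSupport
      have := (hf.comp_fst ρ).mul_bdd (c := y⁻¹) (g := fun p : ℝ × ℝ => y / ((p.2 - p.1) ^ 2 + y ^ 2))
        (by apply Measurable.aestronglyMeasurable; fun_prop) (ae_of_all _ fun p => by
          rw [Real.norm_of_nonneg (by positivity), div_le_iff₀ (by positivity)]
          have : 0 ≤ y⁻¹ * (p.2 - p.1) ^ 2 := by positivity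
          have h : y⁻¹ * y ^ 2 = y := by field_simp
          nlinarith)
      exact this
  have inner_lim : ∀ s : ℝ, Tendsto (fun y : ℝ => ∫ t, f (s + y * t) * (1 + t ^ 2)⁻¹) (𝓝[>] 0)
      (𝓝 (Real.pi * f s)) := by
    intro s
    have : Real.pi * f s = ∫ t, f s * (1 + t ^ 2)⁻¹ := by
      rw [integral_const_mul, integral_univ_inv_one_add_sq, mul_comm]
    rw [this]
    refine tendsto_integral_filter_of_dominated_convergence (fun t => C * (1 + t ^ 2)⁻¹) ?_ ?_ ?_ ?_
    · refine Eventually.of_forall fun y => ?_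
      have : Measurable fun t => f (s + y * t) :=
        (f.continuous.comp (by fun_prop : Continuous fun t : ℝ => s + y * t)).measurable
      exact (this.mul (by fun_prop)).aestronglyMeasurable
    · refine Eventually.of_forall fun y => ae_of_all _ fun t => ?_
      rw [norm_mul, Real.norm_of_nonneg (by positivity : (0:ℝ) ≤ (1 + t ^ 2)⁻¹)]
      gcongr
      exact hC _
    · exact integrable_inv_one_add_sq.const_mul C
    · refine ae_of_all _ fun t => ?_
      apply Tendsto.mul_const
      have : Continuous fun y : ℝ => f (s + y * t) :=
        f.continuous.comp (by fun_prop : Continuous fun y : ℝ => s + y * t)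
      have h := this.tendsto 0
      simp only [zero_mul, add_zero] at h
      exact h.mono_left nhdsWithin_le_nhds
  have outer : Tendsto (fun y : ℝ => ∫ s, (∫ t, f (s + y * t) * (1 + t ^ 2)⁻¹) ∂ρ) (𝓝[>] 0)
      (𝓝 (∫ s, Real.pi * f s ∂ρ)) := by
    refine tendsto_integral_filter_of_dominated_convergence (fun _ => C * Real.pi) ?_ ?_ ?_ ?_
    · refine Eventually.of_forall fun y => ?_
      have : Measurable fun p : ℝ × ℝ => f (p.1 + y * p.2) :=
        (f.continuous.comp (by fun_prop : Continuous fun p : ℝ × ℝ => p.1 + y * p.2)).measurable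
      have h2 : StronglyMeasurable (Function.uncurry fun s t : ℝ => f (s + y * t) * (1 + t ^ 2)⁻¹) :=
        (this.mul (by fun_prop : Measurable fun p : ℝ × ℝ => (1 + p.2 ^ 2)⁻¹)).stronglyMeasurable
      exact (h2.integral_prod_right).aestronglyMeasurable
    · refine Eventually.of_forall fun y => ae_of_all _ fun s => ?_
      rw [← integral_univ_inv_one_add_sq, ← integral_const_mul]
      refine norm_integral_le_of_norm_le (integrable_inv_one_add_sq.const_mul C) (ae_of_all _ fun t => ?_)
      rw [norm_mul, Real.norm_of_nonneg (by positivity : (0:ℝ) ≤ (1 + t ^ 2)⁻¹)]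
      gcongr
      exact hC _
    · exact integrable_const _
    · exact ae_of_all _ inner_lim
  rw [← integral_const_mul]
  refine outer.congr' ?_
  filter_upwards [self_mem_nhdsWithin] with y hy
  exact (key y hy).symm

lemma stieltjes_unique (ρ ρ' : Measure ℝ) [IsFiniteMeasure ρ] [IsFiniteMeasure ρ']
    (h : ∀ z : ℂ, 0 < z.im → ∫ s, ((s : ℂ) - z)⁻¹ ∂ρ = ∫ s, ((s : ℂ) - z)⁻¹ ∂ρ') : ρ = ρ' := by
  apply Measure.ext_of_integral_eq_on_compactlySupported
  intro f
  have h1 := poisson_limit ρ f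
  have h2 := poisson_limit ρ' f
  have h3 := tendsto_nhds_unique (h1.congr' (by
    filter_upwards [self_mem_nhdsWithin] with y hy
    congr 1; ext x
    rw [h _ (by simpa using hy)])) h2
  exact mul_left_cancel₀ Real.pi_ne_zero h3

lemma nev_exists (μ : Measure ℝ) [IsProbabilityMeasure μ]
    (hb : Bornology.IsBounded (msupport μ)) :
    ∃ ρ : Measure ℝ,
      IsFiniteMeasure ρ ∧ ρ Set.univ = ENNReal.ofReal (varM μ) ∧
      ∀ z : ℂ, 0 < z.im →
        Ftransform μ z = z - ((∫ s, s ∂μ : ℝ) : ℂ) + ∫ s, ((s : ℂ) - z)⁻¹ ∂ρ := by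
  have hsupp : msupport μ = μ.support := by
    ext x
    rw [Measure.mem_support_iff_forall]
    simp [msupport, pos_iff_ne_zero]
  obtain ⟨R, hR⟩ := hb.exists_norm_le
  have hae : ∀ᵐ s ∂μ, ‖s‖ ≤ R := by
    filter_upwards [Measure.support_mem_ae (μ := μ)] with s hs
    exact hR s (hsupp ▸ hs)
  have hφ : MemLp (fun s : ℝ => (s : ℂ)) ∞ μ :=
    memLp_top_of_bound (by fun_prop) R (by simpa using hae)
  have hone : MemLp (fun _ : ℝ => (1 : ℂ)) 2 μ := memLp_const 1
  let X : Lp ℂ 2 μ →L[ℂ] Lp ℂ 2 μ :=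
    (ContinuousLinearMap.mul ℂ ℂ).holderL μ ∞ 2 2 (hφ.toLp _)
  have hXc : ∀ f : Lp ℂ 2 μ, ∀ᵐ s ∂μ, X f s = (s : ℂ) * f s := by
    intro f
    filter_upwards [(ContinuousLinearMap.mul ℂ ℂ).coeFn_holder (r := 2) (hφ.toLp _) f, hφ.coeFn_toLp]
      with s h1 h2
    simp only [X, ContinuousLinearMap.holderL_apply_apply]
    rw [h1, h2]; simp
  have hXs : IsSelfAdjoint X := by
    rw [ContinuousLinearMap.isSelfAdjoint_iff_isSymmetric]
    intro f g
    simp only [ContinuousLinearMap.coe_coe, L2.inner_def]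
    apply integral_congr_ae
    filter_upwards [hXc f, hXc g] with s h1 h2
    rw [h1, h2]
    simp
    ring
  let e : Lp ℂ 2 μ := hone.toLp _
  have hec : ∀ᵐ s ∂μ, e s = 1 := hone.coeFn_toLp
  have hein : ∀ f : Lp ℂ 2 μ, inner ℂ e f = ∫ s, f s ∂μ := by
    intro f
    rw [L2.inner_def]
    apply integral_congr_ae
    filter_upwards [hec] with s h1
    rw [h1]; simp
  have hXe : ∀ᵐ s ∂μ, X e s = (s : ℂ) := by
    filter_upwards [hec, hXc e] with s h1 h2
    rw [h2, h1, mul_one]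
  have he : ‖e‖ = 1 := by
    have h1 := inner_self_eq_norm_sq_to_K (𝕜 := ℂ) e
    rw [hein, integral_congr_ae hec] at h1
    simp only [integral_const, probReal_univ, one_smul, Complex.coe_algebraMap] at h1
    have h2 : ‖e‖ ^ 2 = 1 := by exact_mod_cast h1.symm
    exact (pow_eq_one_iff_of_nonneg (norm_nonneg _) two_ne_zero).1 h2
  have hm : inner ℂ e (X e) = ((∫ s, s ∂μ : ℝ) : ℂ) := by
    rw [hein, integral_congr_ae hXe, integral_complex_ofReal]
  obtain ⟨ρ, h1, h2, h3⟩ := schur_aux X hXs e he _ hm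
  refine ⟨ρ, h1, ?_, ?_⟩
  · rw [h2]; congr 1
    unfold varM
    congr 1
    have h1 := inner_self_eq_norm_sq_to_K (𝕜 := ℂ) (X e)
    have h4 : inner ℂ (X e) (X e) = ((∫ s, s ^ 2 ∂μ : ℝ) : ℂ) := by
      rw [L2.inner_def, ← integral_complex_ofReal]
      apply integral_congr_ae
      filter_upwards [hXe] with s hs
      rw [hs, RCLike.inner_apply, Complex.conj_ofReal]; push_cast; ring
    rw [h4] at h1
    simp only [Complex.coe_algebraMap] at h1
    exact_mod_cast h1.symm
  · intro z hz
    obtain ⟨h, he1, he2⟩ := h3 z hz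
    set c := (z - ((∫ s, s ∂μ : ℝ) : ℂ) + ∫ s, ((s : ℂ) - z)⁻¹ ∂ρ) with hc
    have hh : ∀ᵐ s ∂μ, h s = c * (z - (s : ℂ))⁻¹ := by
      have hL : ∀ᵐ s ∂μ, (z • h - X h) s = z * h s - s * h s := by
        filter_upwards [Lp.coeFn_sub (z • h) (X h), Lp.coeFn_smul z h, hXc h] with s a b d
        rw [a, Pi.sub_apply, b, d]; simp
      rw [he2] at hL
      filter_upwards [hL, Lp.coeFn_smul c e, hec] with s a b d
      rw [b, Pi.smul_apply, d] at a
      have hne : z - (s : ℂ) ≠ 0 := by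
        intro h0
        have := congrArg Complex.im h0
        simp at this
        exact hz.ne' this
      rw [eq_mul_inv_iff_mul_eq₀ hne]
      simp at a
      rw [a]; ring
    rw [hein, integral_congr_ae hh, integral_const_mul] at he1
    unfold Ftransform cauchyTransform
    exact (eq_inv_of_mul_eq_one_left he1).symm

/-- Nevanlinna representation: for a compactly supported probability
measure `μ` on `ℝ`, there is a unique finite positive measure `ρ` of total mass
`VAR(μ)` with `F_μ(z) = z - ∫ s dμ + ∫ (s - z)⁻¹ dρ(s)` on the upper half-plane. -/
theorem stmt_8 (μ : Measure ℝ) [IsProbabilityMeasure μ]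
    (hb : Bornology.IsBounded (msupport μ)) :
    ∃! ρ : Measure ℝ,
      IsFiniteMeasure ρ ∧ ρ Set.univ = ENNReal.ofReal (varM μ) ∧
      ∀ z : ℂ, 0 < z.im →
        Ftransform μ z = z - ((∫ s, s ∂μ : ℝ) : ℂ) + ∫ s, ((s : ℂ) - z)⁻¹ ∂ρ := by
  obtain ⟨ρ, h1, h2, h3⟩ := nev_exists μ hb
  refine ⟨ρ, ⟨h1, h2, h3⟩, ?_⟩
  rintro ρ' ⟨h1', _, h3'⟩
  apply stieltjes_unique
  intro z hz
  exact add_left_cancel ((h3' z hz).symm.trans (h3 z hz))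
end

section
/- Let $F : \mathbb{R}^p \times \mathbb{R}^q \to \mathbb{R}^p$ be continuous with $F(\cdot, 0) = \mathrm{id}_{\mathbb{R}^p}$. Let $K \subseteq \mathbb{R}^p$ be a bounded set and $K'$ a compact subset of the interior of $K$. Then there exists a neighborhood $W$ of $0$ in $\mathbb{R}^q$ such that for all $y \in W$, $K' \subseteq F(K, y) := \{F(x,y) : x \in K\}$. -/
open Set Filter Topology MeasureTheory Polynomial in
/-- Extrapolation of polynomials of bounded degree from small nodes to `1`. -/
lemma aux_interp (n : ℕ) {ε : ℝ} (hε : 0 < ε) :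
    ∃ (s : Finset ℝ) (w : ℝ → ℝ), (∀ t ∈ s, 0 < t ∧ t < ε) ∧
      ∀ P : ℝ[X], P.natDegree ≤ n → P.eval 1 = ∑ t ∈ s, w t * P.eval t := by
  obtain ⟨s, hs, hc⟩ := (Ioo_infinite hε).exists_subset_card_eq (n + 1)
  refine ⟨s, fun t => (Lagrange.basis s id t).eval 1, fun t ht => hs ht, fun P hP => ?_⟩
  have hd : P.degree < s.card := by
    rw [hc]
    exact lt_of_le_of_lt Polynomial.degree_le_natDegree (by exact_mod_cast Nat.lt_succ_of_le hP)
  have := Lagrange.eq_interpolate (v := id) (s := s) (Set.injOn_id _) hd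
  conv_lhs => rw [this, Lagrange.interpolate_apply, Polynomial.eval_finsetSum]
  refine Finset.sum_congr rfl fun t _ => ?_
  simp [mul_comm]

open Polynomial in
lemma aux_poly {p : ℕ} (N : ℕ) (M : ℝ) (c x v : Fin p → ℝ)
    (A : (Fin p → ℝ) →L[ℝ] (Fin p → ℝ)) :
    ∃ P : ℝ[X], P.natDegree ≤ 2 * N + p ∧ ∀ t : ℝ, P.eval t =
      (M - ∑ i, ((x + t • v) i - c i) ^ 2) ^ N * (1 + t • A).det := by
  let L := LinearMap.toMatrix' (A : (Fin p → ℝ) →ₗ[ℝ] (Fin p → ℝ))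
  refine ⟨(C M - ∑ i, (C (x i - c i) + X * C (v i)) ^ 2) ^ N *
    Matrix.det ((X : ℝ[X]) • L.map C + (1 : Matrix (Fin p) (Fin p) ℝ).map C), ?_, ?_⟩
  · refine Polynomial.natDegree_mul_le.trans (add_le_add ?_ ?_)
    · refine Polynomial.natDegree_pow_le.trans ?_
      rw [mul_comm]
      refine Nat.mul_le_mul_right _ ?_
      refine (Polynomial.natDegree_sub_le _ _).trans (max_le (by simp) ?_)
      refine Polynomial.natDegree_sum_le_of_forall_le _ _ fun i _ => ?_
      refine Polynomial.natDegree_pow_le.trans ?_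
      have : (C (x i - c i) + X * C (v i)).natDegree ≤ 1 := by compute_degree
      omega
    · simpa using Polynomial.natDegree_det_X_add_C_le L 1
  · intro t
    rw [Polynomial.eval_mul]
    congr 1
    · simp only [eval_pow, eval_sub, eval_C, eval_finsetSum, eval_add, eval_mul, eval_X,
        Pi.add_apply, Pi.smul_apply, smul_eq_mul]
      congr 2
      exact Finset.sum_congr rfl fun i _ => by ring
    · rw [← Polynomial.coe_evalRingHom, RingHom.map_det, ContinuousLinearMap.det,
        ← LinearMap.det_toMatrix']
      congr 1
      ext i j
      by_cases hij : i = j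
      · subst hij
        simp [L, LinearMap.toMatrix'_apply, add_comm]; ring
      · simp [L, LinearMap.toMatrix'_apply, hij]; ring

open Set Filter Topology MeasureTheory in
/-- Change of variables for small perturbations of the identity. -/
lemma aux_small {p : ℕ} (c : Fin p → ℝ) (R : ℝ) (h : (Fin p → ℝ) → (Fin p → ℝ))
    (hh : ContDiff ℝ 1 h) (h0 : ∀ x, x ∉ Metric.closedBall c R → h x = 0) :
    ∃ ε > 0, ∀ t : ℝ, 0 < t → t < ε → ∀ φ : (Fin p → ℝ) → ℝ,
      ∫ x in Metric.closedBall c R, φ (x + t • h x) * (1 + t • fderiv ℝ h x).det =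
        ∫ x in Metric.closedBall c R, φ x := by
  have hB : IsCompact (Metric.closedBall c R) := isCompact_closedBall c R
  obtain ⟨L, hL⟩ := hh.lipschitzWith_of_hasCompactSupport
    (HasCompactSupport.intro hB h0) one_ne_zero
  have hcd : Continuous fun z : ℝ × (Fin p → ℝ) => (1 + z.1 • fderiv ℝ h z.2).det := by
    refine ContinuousLinearMap.continuous_det.comp ?_
    have := hh.continuous_fderiv one_ne_zero
    fun_prop
  have hpos : ∀ᶠ t in 𝓝 (0 : ℝ), ∀ x ∈ Metric.closedBall c R,
      0 < (1 + t • fderiv ℝ h x).det := by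
    refine hB.eventually_forall_of_forall_eventually
      (P := fun (t : ℝ) x => 0 < (1 + t • fderiv ℝ h x).det) fun x _ => ?_
    refine hcd.continuousAt.eventually (lt_mem_nhds ?_)
    simp [ContinuousLinearMap.det]
  obtain ⟨ε, hε, hεp⟩ := Metric.eventually_nhds_iff.1 hpos
  refine ⟨min ε (1 / (L + 1)), by positivity, fun t ht htε φ => ?_⟩
  have ht1 : t < ε := htε.trans_le (min_le_left _ _)
  have ht2 : t * (L + 1) < 1 := by
    have := htε.trans_le (min_le_right _ _)
    rwa [lt_div_iff₀ (by positivity)] at this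
  have hdet : ∀ x ∈ Metric.closedBall c R, 0 < (1 + t • fderiv ℝ h x).det := by
    refine hεp ?_
    simpa [abs_of_pos ht] using ht1
  have hcontr : ∀ y, ContractingWith (⟨t, ht.le⟩ * L) (fun x => y - t • h x) := by
    intro y
    constructor
    · rw [← NNReal.coe_lt_coe]
      push_cast
      change t * L < 1
      nlinarith
    · refine LipschitzWith.of_dist_le_mul fun a b => ?_
      have := hL.dist_le_mul a b
      push_cast
      change _ ≤ t * L * _
      rw [dist_sub_left, dist_smul₀, Real.norm_of_nonneg ht.le, mul_assoc]
      gcongr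
  have hinj : Function.Injective fun x => x + t • h x := by
    intro a b hab
    refine (hcontr (a + t • h a)).fixedPoint_unique' ?_ ?_
    · simp [Function.IsFixedPt]
    · have : a + t • h a = b + t • h b := hab
      simp [Function.IsFixedPt, this]
  have hout : ∀ x, x ∉ Metric.closedBall c R → x + t • h x = x := fun x hx => by
    simp [h0 x hx]
  have himg : (fun x => x + t • h x) '' Metric.closedBall c R = Metric.closedBall c R := by
    ext y
    constructor
    · rintro ⟨x, hx, rfl⟩
      by_contra hy
      have : x + t • h x = x := hinj (hout _ hy)
      simp only at hy
      rw [this] at hy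
      exact hy hx
    · intro hy
      have hx := (hcontr y).fixedPoint_isFixedPt
      set x := ContractingWith.fixedPoint _ (hcontr y)
      have hxy : x + t • h x = y := by
        have : y - t • h x = x := hx
        exact (sub_eq_iff_eq_add.1 this).symm
      refine ⟨x, ?_, hxy⟩
      by_contra hxB
      rw [hout x hxB] at hxy
      exact hxB (hxy ▸ hy)
  have key := integral_image_eq_integral_abs_det_fderiv_smul volume
    (s := Metric.closedBall c R) (f := fun x => x + t • h x)
    (f' := fun x => 1 + t • fderiv ℝ h x) hB.measurableSet (fun x _ => by
      have := (hh.differentiable one_ne_zero x).hasFDerivAt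
      exact ((hasFDerivAt_id x).add (this.const_smul t)).hasFDerivWithinAt) hinj.injOn φ
  rw [himg] at key
  rw [key]
  refine setIntegral_congr_fun hB.measurableSet fun x hx => ?_
  simp only [smul_eq_mul]
  rw [abs_of_pos (hdet x hx), mul_comm]

open Set Filter Topology MeasureTheory in
lemma aux_one {p : ℕ} (c : Fin p → ℝ) (R : ℝ) (h : (Fin p → ℝ) → (Fin p → ℝ))
    (hh : ContDiff ℝ 1 h) (h0 : ∀ x, x ∉ Metric.closedBall c R → h x = 0) (N : ℕ) (M : ℝ) :
    ∫ x in Metric.closedBall c R, (M - ∑ i, ((x + h x) i - c i) ^ 2) ^ N *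
        (1 + fderiv ℝ h x).det =
      ∫ x in Metric.closedBall c R, (M - ∑ i, (x i - c i) ^ 2) ^ N := by
  obtain ⟨ε, hε, hsm⟩ := aux_small c R h hh h0
  obtain ⟨s, w, hs, hw⟩ := aux_interp (2 * N + p) hε
  have hsum : ∑ t ∈ s, w t = 1 := by simpa using (hw 1 (by simp)).symm
  have hB : IsCompact (Metric.closedBall c R) := isCompact_closedBall c R
  have hpt : ∀ x, (M - ∑ i, ((x + h x) i - c i) ^ 2) ^ N * (1 + fderiv ℝ h x).det =
      ∑ t ∈ s, w t * ((M - ∑ i, ((x + t • h x) i - c i) ^ 2) ^ N *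
        (1 + t • fderiv ℝ h x).det) := by
    intro x
    obtain ⟨P, hP, hPe⟩ := aux_poly N M c x (h x) (fderiv ℝ h x)
    have := hw P hP
    simp only [hPe, one_smul] at this
    exact this
  simp_rw [hpt]
  rw [integral_finsetSum]
  · simp_rw [integral_const_mul]
    rw [Finset.sum_congr rfl fun t ht => by
      rw [hsm t (hs t ht).1 (hs t ht).2 (fun z => (M - ∑ i, (z i - c i) ^ 2) ^ N)],
      ← Finset.sum_mul, hsum, one_mul]
  · intro t _
    refine ContinuousOn.integrableOn_compact hB (Continuous.continuousOn ?_)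
    have h1 := hh.continuous
    have h2 : Continuous fun x => (1 + t • fderiv ℝ h x).det := by
      refine ContinuousLinearMap.continuous_det.comp ?_
      have := hh.continuous_fderiv one_ne_zero
      fun_prop
    fun_prop

open Set Filter Topology MeasureTheory in
lemma aux_hit {p : ℕ} (c : Fin p → ℝ) (R : ℝ) (hR : 0 < R) (h : (Fin p → ℝ) → (Fin p → ℝ))
    (hh : ContDiff ℝ 1 h) (h0 : ∀ x, x ∉ Metric.closedBall c R → h x = 0) :
    ∃ x ∈ Metric.closedBall c R, x + h x = c := by
  by_contra! hne
  have hB : IsCompact (Metric.closedBall c R) := isCompact_closedBall c R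
  have hBne : (Metric.closedBall c R).Nonempty := ⟨c, Metric.mem_closedBall_self hR.le⟩
  have hhc := hh.continuous
  let S : (Fin p → ℝ) → ℝ := fun z => ∑ i, (z i - c i) ^ 2
  have hS : Continuous S := by fun_prop
  have hSg : Continuous fun x => S (x + h x) := by fun_prop
  obtain ⟨x₀, hx₀, hmin⟩ := hB.exists_isMinOn hBne hSg.continuousOn
  obtain ⟨x₁, hx₁, hmax₁⟩ := hB.exists_isMaxOn hBne hSg.continuousOn
  obtain ⟨x₂, hx₂, hmax₂⟩ := hB.exists_isMaxOn hBne hS.continuousOn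
  set m := S (x₀ + h x₀) with hm
  have hm0 : 0 < m := by
    have hnn : 0 ≤ m := Finset.sum_nonneg fun i _ => sq_nonneg _
    refine lt_of_le_of_ne hnn fun h0 => hne x₀ hx₀ ?_
    have := (Finset.sum_eq_zero_iff_of_nonneg (fun i _ => sq_nonneg _)).1 h0.symm
    ext i
    have := this i (Finset.mem_univ i)
    have := pow_eq_zero_iff (two_ne_zero) |>.1 this
    linarith
  set M := max (S (x₁ + h x₁)) (S x₂) with hM
  have hM1 : ∀ x ∈ Metric.closedBall c R, S (x + h x) ≤ M := fun x hx =>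
    (hmax₁ hx).trans (le_max_left _ _)
  have hM2 : ∀ x ∈ Metric.closedBall c R, S x ≤ M := fun x hx =>
    (hmax₂ hx).trans (le_max_right _ _)
  have hmm : ∀ x ∈ Metric.closedBall c R, m ≤ S (x + h x) := fun x hx => hmin hx
  have hmM : m ≤ M := (hmm x₀ hx₀).trans (hM1 x₀ hx₀)
  have hdc : Continuous fun x => (1 + fderiv ℝ h x).det := by
    refine ContinuousLinearMap.continuous_det.comp ?_
    have := hh.continuous_fderiv one_ne_zero
    fun_prop
  let D := ∫ x in Metric.closedBall c R, |(1 + fderiv ℝ h x).det|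
  let U : Set (Fin p → ℝ) := Metric.ball c R ∩ {z | S z < m / 2}
  have hUo : IsOpen U := Metric.isOpen_ball.inter (isOpen_lt hS continuous_const)
  have hUsub : U ⊆ Metric.closedBall c R := fun z hz => Metric.ball_subset_closedBall hz.1
  have hUne : U.Nonempty := ⟨c, Metric.mem_ball_self hR, by simp [S, hm0]⟩
  have hUfin : volume U < ⊤ := (measure_mono hUsub).trans_lt hB.measure_lt_top
  have hv : 0 < (volume U).toReal :=
    ENNReal.toReal_pos (hUo.measure_pos volume hUne).ne' hUfin.ne
  have key : ∀ N : ℕ, (M - m / 2) ^ N * (volume U).toReal ≤ (M - m) ^ N * D := by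
    intro N
    have hone := aux_one c R h hh h0 N M
    calc (M - m / 2) ^ N * (volume U).toReal = ∫ x in U, (M - m / 2) ^ N := by
          simp [Measure.real, mul_comm]
      _ ≤ ∫ x in U, (M - S x) ^ N := by
          refine setIntegral_mono_on (integrableOn_const hUfin.ne) ?_ hUo.measurableSet ?_
          · refine IntegrableOn.mono_set ?_ hUsub
            exact ContinuousOn.integrableOn_compact hB (by fun_prop)
          · intro x hx
            have : S x < m / 2 := hx.2
            exact pow_le_pow_left₀ (by linarith) (by linarith) _
      _ ≤ ∫ x in Metric.closedBall c R, (M - S x) ^ N := by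
          refine setIntegral_mono_set (ContinuousOn.integrableOn_compact hB (by fun_prop)) ?_
            (LE.le.eventuallyLE hUsub)
          refine (ae_restrict_iff' hB.measurableSet).2 (Eventually.of_forall fun x hx => ?_)
          exact pow_nonneg (sub_nonneg.2 (hM2 x hx)) _
      _ = ∫ x in Metric.closedBall c R, (M - S (x + h x)) ^ N * (1 + fderiv ℝ h x).det :=
          hone.symm
      _ ≤ ∫ x in Metric.closedBall c R, (M - m) ^ N * |(1 + fderiv ℝ h x).det| := by
          refine setIntegral_mono_on (ContinuousOn.integrableOn_compact hB (by fun_prop))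
            (ContinuousOn.integrableOn_compact hB
              (continuous_const.mul hdc.abs).continuousOn) hB.measurableSet fun x hx => ?_
          have h1 := hM1 x hx
          have h2 := hmm x hx
          exact (mul_le_mul_of_nonneg_left (le_abs_self _)
            (pow_nonneg (by linarith) _)).trans (mul_le_mul_of_nonneg_right
              (pow_le_pow_left₀ (by linarith) (by linarith) _) (abs_nonneg _))
      _ = (M - m) ^ N * D := integral_const_mul _ _
  have hb : 0 < M - m / 2 := by linarith
  have hlim : Tendsto (fun N : ℕ => ((M - m) / (M - m / 2)) ^ N * D) atTop (𝓝 (0 * D)) := by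
    refine (tendsto_pow_atTop_nhds_zero_of_lt_one (div_nonneg (by linarith) hb.le) ?_).mul_const D
    rw [div_lt_one hb]; linarith
  have : (volume U).toReal ≤ 0 * D := by
    refine ge_of_tendsto' hlim fun N => ?_
    rw [div_pow, div_mul_eq_mul_div, le_div_iff₀ (by positivity), mul_comm]
    exact key N
  linarith

open Set Filter Topology in
lemma aux_cont {p : ℕ} (c : Fin p → ℝ) (R : ℝ) (hR : 0 < R) (G : (Fin p → ℝ) → (Fin p → ℝ))
    (hG : Continuous G) (hGn : ∀ x ∈ Metric.closedBall c R, dist (G x) x ≤ R / 4) :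
    ∃ x ∈ Metric.closedBall c R, G x = c := by
  by_contra! hne
  have hB : IsCompact (Metric.closedBall c R) := isCompact_closedBall c R
  have hBne : (Metric.closedBall c R).Nonempty := ⟨c, Metric.mem_closedBall_self hR.le⟩
  obtain ⟨x₀, hx₀, hmin⟩ := hB.exists_isMinOn hBne
    (f := fun x => dist (G x) c) (by fun_prop)
  have hd : 0 < dist (G x₀) c := dist_pos.2 (hne x₀ hx₀)
  set η := min (dist (G x₀) c) (R / 8) with hη
  have hη0 : 0 < η := by positivity
  obtain ⟨v, hv, hvd, -⟩ := Continuous.exists_contDiff_approx (f := fun x => G x - x) 1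
    (by fun_prop) (ε := fun _ => η) continuous_const (fun _ => hη0)
  let χ : ContDiffBump c := ⟨R / 2, R, by linarith, by linarith⟩
  obtain ⟨x, hx, hxc⟩ := aux_hit c R hR (fun x => χ x • v x)
    (χ.contDiff.smul hv) (fun x hx => by
      have : χ x = 0 := χ.zero_of_le_dist (by
        simp only [Metric.mem_closedBall, not_le] at hx
        exact hx.le)
      simp [this])
  have h1 := hvd x
  by_cases hxR : dist x c ≤ R / 2
  · have : χ x = 1 := χ.one_of_mem_closedBall hxR
    simp only [this, one_smul] at hxc
    have h2 : dist (G x₀) c ≤ dist (G x) c := hmin hx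
    have h3 : dist (G x) c = dist (v x) (G x - x) := by
      rw [← hxc, dist_comm, dist_eq_norm, dist_eq_norm]
      congr 1
      abel
    have := min_le_left (dist (G x₀) c) (R / 8)
    linarith
  · have h4 : ‖χ x • v x‖ ≤ ‖v x‖ := by
      rw [norm_smul, Real.norm_of_nonneg χ.nonneg]
      exact mul_le_of_le_one_left (norm_nonneg _) χ.le_one
    have h5 : dist x c = ‖χ x • v x‖ := by
      rw [dist_comm, dist_eq_norm]
      congr 1
      exact sub_eq_iff_eq_add'.2 hxc.symm
    have h6 : ‖v x‖ ≤ dist (v x) (G x - x) + dist (G x) x := by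
      rw [dist_eq_norm, dist_eq_norm]
      simpa using norm_add_le (v x - (G x - x)) (G x - x)
    have := hGn x hx
    have := min_le_right (dist (G x₀) c) (R / 8)
    linarith

/-- if `F : ℝᵖ × ℝ^q → ℝᵖ` is continuous with `F(·, 0) = id`, `K ⊆ ℝᵖ`
is bounded and `K'` is a compact subset of the interior of `K`, then for all `y` in a
neighborhood of `0`, `K' ⊆ F(K, y)`. -/
theorem stmt_15 {p q : ℕ} (F : (Fin p → ℝ) × (Fin q → ℝ) → Fin p → ℝ)
    (hF : Continuous F) (hid : ∀ x, F (x, 0) = x)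
    (K K' : Set (Fin p → ℝ)) (hK : Bornology.IsBounded K)
    (hK' : IsCompact K') (hsub : K' ⊆ interior K) :
    ∃ W ∈ nhds (0 : Fin q → ℝ), ∀ y ∈ W, K' ⊆ (fun x => F (x, y)) '' K := by
  obtain ⟨R, hR, hRK⟩ := hK'.exists_cthickening_subset_open isOpen_interior hsub
  have hball : ∀ c ∈ K', Metric.closedBall c R ⊆ K := fun c hc =>
    ((Metric.closedBall_subset_cthickening hc R).trans hRK).trans interior_subset
  have hcl : IsCompact (closure K) := hK.isCompact_closure
  have hev : ∀ᶠ y in nhds (0 : Fin q → ℝ), ∀ x ∈ closure K, dist (F (x, y)) x < R / 4 := by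
    refine hcl.eventually_forall_of_forall_eventually
      (P := fun y x => dist (F (x, y)) x < R / 4) fun x _ => ?_
    have hc : Continuous fun z : (Fin q → ℝ) × (Fin p → ℝ) => dist (F (z.2, z.1)) z.2 := by
      fun_prop
    refine hc.continuousAt.eventually (gt_mem_nhds ?_)
    simp only [hid, dist_self]
    positivity
  refine ⟨_, hev, fun y hy c hc => ?_⟩
  obtain ⟨x, hx, hxc⟩ := aux_cont c R hR (fun x => F (x, y)) (by fun_prop) fun x hx =>
    (hy x (subset_closure (hball c hc hx))).le
  exact ⟨x, hball c hc hx, hxc⟩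
end
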